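/- (Matrix Handelman Positivstellensatz, linear case) Let G(x) = A_0 + x_1 A_1 + ... + x_n A_n with A_0,...,A_n q×q symmetric real matrices, and K = {x ∈ ℝ^n : G(x) ⪰ 0}. Suppose K is compact with nonempty interior. If f ∈ ℝ[x_1,...,x_n] satisfies f(x) > 0 for all x ∈ K, then there exist m ∈ ℕ, a real number λ_0 ≥ 0, and positive semidefinite real matrices Λ_k of size q^k × q^k for k = 1,...,m, such that f(x) = λ_0 + Σ_{k=1}^m ⟨Λ_k, G(x)^{⊗k}⟩ identically as polynomials in x. -/

import Mathlib

open scoped BigOperators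

noncomputable section

/-- The `k`-fold Kronecker power of a matrix, with rows and columns indexed by
functions `Fin k → ι` (a type of cardinality `(#ι)^k`):
`(M^{⊗k})_{a,b} = ∏ᵢ M_{a i, b i}`. -/
def kronPow {ι : Type*} {R : Type*} [CommMonoid R] (M : Matrix ι ι R) (k : ℕ) :
    Matrix (Fin k → ι) (Fin k → ι) R :=
  Matrix.of fun a b => ∏ i, M (a i) (b i)

/-- Trace inner product `⟨Λ, B⟩ = tr(Λᵀ B) = ∑ᵢⱼ Λᵢⱼ Bᵢⱼ` of a real matrix against a
polynomial matrix. -/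
def tipP {n : ℕ} {ι : Type*} [Fintype ι] (Λ : Matrix ι ι ℝ)
    (B : Matrix ι ι (MvPolynomial (Fin n) ℝ)) : MvPolynomial (Fin n) ℝ :=
  ∑ i, ∑ j, MvPolynomial.C (Λ i j) * B i j

/-- The cone `H(G)` of all polynomials of the form
`λ₀ + ∑_{k=1}^m ⟨Λ_k, G(x)^{⊗k}⟩` with `λ₀ ≥ 0` and each `Λ_k` positive semidefinite. -/
def Hset {n : ℕ} {ι : Type*} [Fintype ι]
    (G : Matrix ι ι (MvPolynomial (Fin n) ℝ)) : Set (MvPolynomial (Fin n) ℝ) :=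
  { p | ∃ (m : ℕ) (lam0 : ℝ) (Λ : (k : ℕ) → Matrix (Fin k → ι) (Fin k → ι) ℝ),
      0 ≤ lam0 ∧ (∀ k ∈ Finset.Icc 1 m, (Λ k).PosSemidef) ∧
      p = MvPolynomial.C lam0 + ∑ k ∈ Finset.Icc 1 m, tipP (Λ k) (kronPow G k) }

/-- The linear polynomial matrix `G(x) = A₀ + ∑ₗ xₗ Aₗ`. -/
def linMat {n q : ℕ} (A0 : Matrix (Fin q) (Fin q) ℝ)
    (A : Fin n → Matrix (Fin q) (Fin q) ℝ) :
    Matrix (Fin q) (Fin q) (MvPolynomial (Fin n) ℝ) :=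
  Matrix.of fun i j =>
    MvPolynomial.C (A0 i j) + ∑ l, MvPolynomial.X l * MvPolynomial.C (A l i j)

/-- Entrywise evaluation of a polynomial matrix at a point `x`. -/
def evalMat {n : ℕ} {ι : Type*} (x : Fin n → ℝ)
    (B : Matrix ι ι (MvPolynomial (Fin n) ℝ)) : Matrix ι ι ℝ :=
  Matrix.of fun i j => MvPolynomial.eval x (B i j)

/-- A convex cone with an order unit `u` such that `-u` is outside the cone admits a nonnegative
functional normalised at `u`. -/
theorem PointedCone.exists_linearMap_of_orderUnit {E : Type*} [AddCommGroup E] [Module ℝ E]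
    (C : PointedCone ℝ E) (u : E) (hu : ∀ y, ∃ N : ℝ, N • u + y ∈ C) (hneg : -u ∉ C) :
    ∃ g : E →ₗ[ℝ] ℝ, g u = 1 ∧ ∀ x ∈ C, 0 ≤ g x := by
  have hu0 : u ≠ 0 := by
    rintro rfl
    exact hneg (by simp)
  obtain ⟨g, hg, hgC⟩ := riesz_extension C (LinearPMap.mkSpanSingleton u (1 : ℝ) hu0) (by
    rintro ⟨x, hx⟩ hxC
    obtain ⟨c, rfl⟩ := Submodule.mem_span_singleton.1 hx
    rw [LinearPMap.mkSpanSingleton'_apply]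
    simp only [smul_eq_mul, mul_one, RingHom.id_apply]
    by_contra! hc
    apply hneg
    have h := C.smul_mem (inv_nonneg.2 (neg_nonneg.2 hc.le)) hxC
    convert h using 1
    rw [smul_smul, inv_neg, neg_mul, inv_mul_cancel₀ hc.ne, neg_one_smul])
    (fun y => by
      obtain ⟨N, hN⟩ := hu y
      exact ⟨⟨N • u, Submodule.mem_span_singleton.2 ⟨N, rfl⟩⟩, hN⟩)
  refine ⟨g, ?_, hgC⟩
  rw [hg ⟨u, Submodule.mem_span_singleton_self u⟩]
  exact LinearPMap.mkSpanSingleton_apply ℝ ℝ hu0 1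

/-- A convex cone in a finite-dimensional space is everything if no nonzero functional is
nonnegative on it. -/
theorem PointedCone.eq_top_of_forall_linearMap_eq_zero {E : Type*} [AddCommGroup E] [Module ℝ E]
    [FiniteDimensional ℝ E] (C : PointedCone ℝ E)
    (h : ∀ g : E →ₗ[ℝ] ℝ, (∀ x ∈ C, 0 ≤ g x) → g = 0) : C = ⊤ := by
  classical
  have hspan : Submodule.span ℝ (C : Set E) = ⊤ := by
    by_contra hne
    obtain ⟨g, hg0, hg⟩ := Submodule.exists_le_ker_of_lt_top _ (lt_top_iff_ne_top.2 hne)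
    exact hg0 (h g fun x hx => (LinearMap.mem_ker.1 (hg (Submodule.subset_span hx))).ge)
  obtain ⟨S, hSC, hS⟩ := (Submodule.fg_span_iff_fg_span_finset_subset (R := ℝ) (C : Set E)).1
    (IsNoetherian.noetherian _)
  have hsmul : ∀ (r : ℝ), 0 ≤ r → ∀ x ∈ C, r • x ∈ C := fun r hr x hx =>
    C.smul_mem hr hx
  set u := ∑ x ∈ S, x with hu
  have huC : u ∈ C := C.sum_mem fun x hx => hSC hx
  have hunit : ∀ y : E, ∃ N : ℝ, 0 ≤ N ∧ N • u + y ∈ C ∧ N • u - y ∈ C := by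
    intro y
    have hy : y ∈ Submodule.span ℝ (S : Set E) := by rw [← hS, hspan]; trivial
    induction hy using Submodule.span_induction with
    | mem x hx =>
      refine ⟨1, zero_le_one, ?_, ?_⟩
      · rw [one_smul]; exact C.add_mem huC (hSC hx)
      · rw [one_smul, hu, ← Finset.sum_erase_eq_sub hx]
        exact C.sum_mem fun z hz => hSC (Finset.mem_of_mem_erase hz)
    | zero => exact ⟨0, le_rfl, by simp, by simp⟩
    | add x z _ _ hx hz =>
      obtain ⟨a, ha, h1, h2⟩ := hx
      obtain ⟨b, hb, h3, h4⟩ := hz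
      refine ⟨a + b, by positivity, ?_, ?_⟩
      · convert C.add_mem h1 h3 using 1; module
      · convert C.add_mem h2 h4 using 1; module
    | smul r x _ hx =>
      obtain ⟨a, ha, h1, h2⟩ := hx
      refine ⟨|r| * a, by positivity, ?_⟩
      rcases le_total 0 r with hr | hr
      · rw [abs_of_nonneg hr]
        constructor
        · convert hsmul r hr _ h1 using 1; module
        · convert hsmul r hr _ h2 using 1; module
      · rw [abs_of_nonpos hr]
        constructor
        · convert hsmul (-r) (by linarith) _ h2 using 1; module
        · convert hsmul (-r) (by linarith) _ h1 using 1; module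
  by_cases hneg : -u ∈ C
  · refine eq_top_iff.2 fun y _ => ?_
    obtain ⟨N, hN, h1, -⟩ := hunit y
    convert C.add_mem h1 (hsmul N hN _ hneg) using 1; module
  · obtain ⟨g, hg1, hg⟩ := PointedCone.exists_linearMap_of_orderUnit C u
      (fun y => (hunit y).imp fun N hN => hN.2.1) hneg
    simp [h g hg] at hg1

/-- **Representation theorem** for archimedean semirings: an element outside an archimedean
subsemiring `T` of a commutative real algebra is nonpositive under some character that is
nonnegative on `T`. The character is an extreme point of the face of the positive functionals,
normalised at `1`, on which evaluation at `f` is minimal. -/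
theorem exists_algHom_nonneg_of_notMem {R : Type*} [CommRing R] [Algebra ℝ R] (T : Subsemiring R)
    (hT : ∀ r : ℝ, 0 ≤ r → algebraMap ℝ R r ∈ T)
    (harch : ∀ p : R, ∃ N : ℝ, algebraMap ℝ R N - p ∈ T)
    {f : R} (hf : f ∉ T) :
    ∃ φ : R →ₐ[ℝ] ℝ, (∀ t ∈ T, 0 ≤ φ t) ∧ φ f ≤ 0 := by
  have hsmul : ∀ (r : ℝ), 0 ≤ r → ∀ x ∈ T, r • x ∈ T := fun r hr x hx => by
    rw [Algebra.smul_def]; exact T.mul_mem (hT r hr) hx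
  have hdiff : ∀ p : R, ∃ N : ℝ, 0 < N ∧ algebraMap ℝ R N - p ∈ T := fun p => by
    obtain ⟨N, hN⟩ := harch p
    refine ⟨max N 1, by positivity, ?_⟩
    convert T.add_mem hN (hT (max N 1 - N) (by simp)) using 1
    rw [map_sub]; ring
  -- the normalised positive functionals on `R`
  let S : Set (R → ℝ) := {L | (∀ p q, L (p + q) = L p + L q) ∧ (∀ (r : ℝ) p, L (r • p) = r * L p) ∧
    (∀ t ∈ T, 0 ≤ L t) ∧ L 1 = 1}
  have hSmap : ∀ L ∈ S, ∀ N : ℝ, L (algebraMap ℝ R N) = N := by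
    rintro L ⟨-, h2, -, h4⟩ N
    rw [Algebra.algebraMap_eq_smul_one, h2, h4, mul_one]
  have hSsub : ∀ L ∈ S, ∀ p q, L (p - q) = L p - L q := by
    rintro L ⟨h1, -, -, -⟩ p q
    rw [eq_sub_iff_add_eq, ← h1, sub_add_cancel]
  have hle : ∀ L ∈ S, ∀ (N : ℝ) p, algebraMap ℝ R N - p ∈ T → L p ≤ N := by
    intro L hL N p h
    have := hL.2.2.1 _ h
    rw [hSsub L hL, hSmap L hL] at this
    linarith
  have hScomp : IsCompact S := by
    choose N hN0 hN using hdiff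
    refine (isCompact_univ_pi fun p : R => isCompact_Icc (a := -N (-p)) (b := N p)).of_isClosed_subset
      ?_ ?_
    · simp only [S, Set.ofPred_and, Set.ofPred_forall]
      refine ((isClosed_iInter fun p => isClosed_iInter fun q => ?_).inter <|
        (isClosed_iInter fun r => isClosed_iInter fun p => ?_).inter <|
        (isClosed_iInter fun t => isClosed_iInter fun ht => ?_).inter ?_)
      · exact isClosed_eq (by fun_prop) (by fun_prop)
      · exact isClosed_eq (by fun_prop) (by fun_prop)
      · exact isClosed_le (by fun_prop) (by fun_prop)
      · exact isClosed_eq (by fun_prop) (by fun_prop)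
    · intro L hL p _
      refine ⟨?_, hle L hL _ _ (hN p)⟩
      have h1 := hle L hL _ _ (hN (-p))
      have h2 := hSsub L hL 0 p
      have h3 := hSsub L hL 0 0
      simp only [sub_zero, zero_sub] at h2 h3
      linarith
  obtain ⟨L₀, hL₀, hL₀f⟩ : ∃ L ∈ S, L f ≤ 0 := by
    let C : PointedCone ℝ R :=
      { carrier := {x | ∃ t ∈ T, ∃ r : ℝ, 0 ≤ r ∧ x = t - r • f}
        zero_mem' := ⟨0, T.zero_mem, 0, le_rfl, by simp⟩
        add_mem' := by
          rintro _ _ ⟨t, ht, r, hr, rfl⟩ ⟨t', ht', r', hr', rfl⟩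
          exact ⟨t + t', T.add_mem ht ht', r + r', by positivity, by module⟩
        smul_mem' := by
          rintro ⟨c, hc⟩ _ ⟨t, ht, r, hr, rfl⟩
          refine ⟨c • t, hsmul c hc t ht, c * r, by positivity, ?_⟩
          change c • (t - r • f) = _
          module }
    have hTC : ∀ t ∈ T, t ∈ C := fun t ht => ⟨t, ht, 0, le_rfl, by simp⟩
    obtain ⟨g, hg1, hg⟩ := PointedCone.exists_linearMap_of_orderUnit C 1 (fun y => by
        obtain ⟨N, hN⟩ := harch (-y)
        refine ⟨N, hTC _ ?_⟩
        rwa [← Algebra.algebraMap_eq_smul_one, ← sub_neg_eq_add]) (by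
        rintro ⟨t, ht, r, hr, h⟩
        rcases hr.eq_or_lt with rfl | hr
        · obtain ⟨N, hN0, hN⟩ := hdiff (-f)
          apply hf
          convert T.add_mem hN (hsmul N hN0.le t ht) using 1
          rw [zero_smul, sub_zero] at h
          rw [← h, Algebra.algebraMap_eq_smul_one]; module
        · apply hf
          convert hsmul r⁻¹ (by positivity) _ (T.add_mem ht T.one_mem) using 1
          have : t + 1 = r • f := by linear_combination -h
          rw [this, inv_smul_smul₀ hr.ne'])
    refine ⟨g, ⟨map_add g, fun r p => by simp, fun t ht => hg t (hTC t ht), hg1⟩, ?_⟩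
    have := hg (-f) ⟨0, T.zero_mem, 1, zero_le_one, by simp⟩
    simpa using this
  obtain ⟨M, hMS, hM⟩ := hScomp.exists_isMinOn ⟨L₀, hL₀⟩
    (f := fun L : R → ℝ => L f) (by fun_prop)
  have hMf : M f ≤ 0 := (hM hL₀).trans hL₀f
  have hFcomp : IsCompact (S ∩ {L | L f = M f}) :=
    hScomp.inter_right (isClosed_eq (by fun_prop) (by fun_prop))
  obtain ⟨L, hL⟩ := hFcomp.extremePoints_nonempty ⟨M, hMS, rfl⟩
  obtain ⟨⟨hLS, hLf⟩, hLext⟩ := mem_extremePoints.1 hL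
  have hmin : ∀ L' ∈ S, L f ≤ L' f := fun L' hL' => by rw [hLf]; exact hM hL'
  have hLS' := hLS
  obtain ⟨hadd, hsm, hpos, hone⟩ := hLS'
  have hmulT : ∀ t ∈ T, 1 - t ∈ T → 0 < L t → 0 < L (1 - t) → ∀ p, L (t * p) = L t * L p := by
    intro t ht ht' h0 h1 p
    have key : ∀ s ∈ T, 0 < L s → (fun p => (L s)⁻¹ * L (s * p)) ∈ S := by
      intro s hs hs0
      refine ⟨fun p q => ?_, fun r p => ?_, fun q hq => ?_, ?_⟩
      · simp only [mul_add, hadd]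
      · simp only [mul_smul_comm, hsm]; ring
      · have := hpos _ (T.mul_mem hs hq)
        positivity
      · simp [hs0.ne']
    have hsum : L t + L (1 - t) = 1 := by rw [← hadd]; simpa using hone
    have hcomb : ∀ p, L p = L t * ((L t)⁻¹ * L (t * p)) +
        L (1 - t) * ((L (1 - t))⁻¹ * L ((1 - t) * p)) := fun p => by
      rw [mul_inv_cancel_left₀ h0.ne', mul_inv_cancel_left₀ h1.ne', ← hadd]
      congr 1; ring
    have k1 := key t ht h0
    have k2 := key (1 - t) ht' h1
    have m1 := hmin _ k1
    have m2 := hmin _ k2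
    have hcf := hcomb f
    have hext : ∀ a b x y z : ℝ, 0 < a → 0 < b → a + b = 1 → z = a * x + b * y → z ≤ x → z ≤ y →
        x = z := by
      intro a b x y z ha hb hab hz hx hy
      obtain rfl : b = 1 - a := by linarith
      refine le_antisymm (le_of_mul_le_mul_left ?_ ha) hx
      linarith [mul_le_mul_of_nonneg_left hy hb.le]
    have e1 : (L t)⁻¹ * L (t * f) = L f := hext _ _ _ _ _ h0 h1 hsum hcf m1 m2
    have e2 : (L (1 - t))⁻¹ * L ((1 - t) * f) = L f :=
      hext _ _ _ _ _ h1 h0 (by rw [add_comm, hsum]) (by rw [add_comm, ← hcf]) m2 m1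
    have := (hLext _ ⟨k1, e1.trans hLf⟩ _ ⟨k2, e2.trans hLf⟩
      ⟨L t, L (1 - t), h0, h1, hsum, by ext p; exact (hcomb p).symm⟩).1
    rw [← congrFun this p, mul_inv_cancel_left₀ h0.ne']
  have hmul : ∀ p q, L (p * q) = L p * L q := by
    intro p q
    obtain ⟨a, ha, hpa⟩ := hdiff p
    obtain ⟨b, hb, hpb⟩ := hdiff (-p)
    -- `t = (p + b + 1) / (a + b + 2)` is strictly between `0` and `1` at `L`
    have hs : 0 < a + b + 2 := by positivity
    set c := (a + b + 2)⁻¹ with hc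
    have hc0 : 0 < c := by positivity
    have hcs : c * (a + b + 2) = 1 := inv_mul_cancel₀ hs.ne'
    let t : R := c • (p + algebraMap ℝ R (b + 1))
    have ht : t ∈ T := hsmul c hc0.le _ (by
      convert T.add_mem hpb T.one_mem using 1
      simp only [map_add, map_one]; ring)
    have ht' : 1 - t = c • (algebraMap ℝ R (a + 1) - p) := by
      have : (1 : R) = c • algebraMap ℝ R (a + b + 2) := by
        rw [Algebra.smul_def, ← map_mul, hcs, map_one]
      rw [this, ← smul_sub]
      congr 1
      simp only [map_add, map_one, map_ofNat]; ring
    have htT : 1 - t ∈ T := by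
      rw [ht']
      refine hsmul c hc0.le _ ?_
      convert T.add_mem hpa T.one_mem using 1
      simp only [map_add, map_one]; ring
    have hLt : L t = c * (L p + (b + 1)) := by
      simp only [t, hsm, hadd, hSmap L hLS]
    have hLt' : L (1 - t) = c * ((a + 1) - L p) := by
      rw [ht', hsm, hSsub L hLS, hSmap L hLS]
    have h1 := hle L hLS _ _ hpa
    have h2 : -L p ≤ b := by
      have := hpos _ hpb
      rw [sub_neg_eq_add, hadd, hSmap L hLS] at this
      linarith
    have h := hmulT t ht htT (by rw [hLt]; apply mul_pos hc0; linarith)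
      (by rw [hLt']; apply mul_pos hc0; linarith) q
    have h3 : L (t * q) = c * (L (p * q) + (b + 1) * L q) := by
      simp only [t, smul_mul_assoc, hsm, add_mul, hadd, ← Algebra.smul_def]
    rw [h3, hLt, mul_assoc] at h
    have := mul_left_cancel₀ hc0.ne' h
    linarith
  have hzero : L 0 = 0 := by simpa using hSmap L hLS 0
  exact ⟨{ toFun := L
           map_one' := hone
           map_mul' := hmul
           map_zero' := hzero
           map_add' := hadd
           commutes' := hSmap L hLS }, hpos, hLf.trans_le hMf⟩

/-- A subsemiring of a polynomial ring containing the nonnegative constants is archimedean as soon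
as the variables are bounded with respect to it. -/
theorem exists_C_sub_mem_of_X {σ : Type*} (T : Subsemiring (MvPolynomial σ ℝ))
    (hT : ∀ r : ℝ, 0 ≤ r → MvPolynomial.C r ∈ T)
    (hX : ∀ l, (∃ N : ℝ, MvPolynomial.C N - MvPolynomial.X l ∈ T) ∧
      ∃ N : ℝ, MvPolynomial.C N + MvPolynomial.X l ∈ T) (p : MvPolynomial σ ℝ) :
    ∃ N : ℝ, MvPolynomial.C N - p ∈ T := by
  have hmono : ∀ {a b : ℝ} {p : MvPolynomial σ ℝ}, a ≤ b → MvPolynomial.C a + p ∈ T →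
      MvPolynomial.C b + p ∈ T := fun {a b p} hab h => by
    convert T.add_mem (hT (b - a) (sub_nonneg.2 hab)) h using 1
    rw [map_sub]; ring
  have hX' : ∀ l, ∃ N : ℝ, MvPolynomial.C N - MvPolynomial.X l ∈ T ∧
      MvPolynomial.C N + MvPolynomial.X l ∈ T := fun l => by
    obtain ⟨⟨a, ha⟩, b, hb⟩ := hX l
    rw [sub_eq_add_neg] at ha
    exact ⟨max a b, by rw [sub_eq_add_neg]; exact hmono (le_max_left _ _) ha,
      hmono (le_max_right _ _) hb⟩
  suffices h : ∃ N : ℝ, MvPolynomial.C N - p ∈ T ∧ MvPolynomial.C N + p ∈ T from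
    h.imp fun _ h => h.1
  induction p using MvPolynomial.induction_on with
  | C a =>
    refine ⟨|a|, ?_, ?_⟩
    · rw [← map_sub]; exact hT _ (sub_nonneg.2 (le_abs_self a))
    · rw [← map_add]; exact hT _ (by linarith [neg_abs_le a])
  | add p q hp hq =>
    obtain ⟨a, h1, h2⟩ := hp
    obtain ⟨b, h3, h4⟩ := hq
    refine ⟨a + b, ?_, ?_⟩
    · convert T.add_mem h1 h3 using 1; rw [map_add]; ring
    · convert T.add_mem h2 h4 using 1; rw [map_add]; ring
  | mul_X p l hp =>
    obtain ⟨a, h1, h2⟩ := hp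
    obtain ⟨b, h3, h4⟩ := hX' l
    have half : MvPolynomial.C (1 / 2 : ℝ) * 2 = (1 : MvPolynomial σ ℝ) := by
      rw [← map_ofNat (MvPolynomial.C (σ := σ) (R := ℝ)) 2, ← map_mul]; norm_num
    have h2' := hT (1 / 2) (by norm_num)
    refine ⟨a * b, ?_, ?_⟩
    · convert T.mul_mem h2' (T.add_mem (T.mul_mem h1 h4) (T.mul_mem h2 h3)) using 1
      rw [map_mul]
      linear_combination (-(MvPolynomial.C a * MvPolynomial.C b) + p * MvPolynomial.X l) * half
    · convert T.mul_mem h2' (T.add_mem (T.mul_mem h2 h4) (T.mul_mem h1 h3)) using 1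
      rw [map_mul]
      linear_combination (-(MvPolynomial.C a * MvPolynomial.C b) - p * MvPolynomial.X l) * half

theorem kronPow_add {ι R : Type*} [CommMonoid R] (M : Matrix ι ι R) (j k : ℕ) :
    (kronPow M (j + k)).submatrix (Fin.appendEquiv j k) (Fin.appendEquiv j k) =
      Matrix.kroneckerMap (· * ·) (kronPow M j) (kronPow M k) := by
  ext a b
  simp [kronPow, Fin.appendEquiv, Fin.prod_univ_add]

theorem kronPow_one {ι R : Type*} [CommMonoid R] (M : Matrix ι ι R) :
    (kronPow M 1).submatrix (Equiv.funUnique (Fin 1) ι).symm (Equiv.funUnique (Fin 1) ι).symm =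
      M := by
  ext a b
  simp [kronPow]

section tipP

variable {n : ℕ} {ι κ : Type*} [Fintype ι] [Fintype κ]

theorem tipP_zero (B : Matrix ι ι (MvPolynomial (Fin n) ℝ)) : tipP 0 B = 0 := by
  simp [tipP]

theorem tipP_add (Λ M : Matrix ι ι ℝ) (B : Matrix ι ι (MvPolynomial (Fin n) ℝ)) :
    tipP (Λ + M) B = tipP Λ B + tipP M B := by
  simp [tipP, add_mul, Finset.sum_add_distrib]

theorem tipP_submatrix (e : κ ≃ ι) (Λ : Matrix κ κ ℝ) (B : Matrix ι ι (MvPolynomial (Fin n) ℝ)) :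
    tipP (Λ.submatrix e.symm e.symm) B = tipP Λ (B.submatrix e e) := by
  simp only [tipP, ← e.sum_comp, Matrix.submatrix_apply, Equiv.symm_apply_apply]

theorem tipP_kroneckerMap (Λ : Matrix ι ι ℝ) (M : Matrix κ κ ℝ)
    (B : Matrix ι ι (MvPolynomial (Fin n) ℝ)) (D : Matrix κ κ (MvPolynomial (Fin n) ℝ)) :
    tipP (Matrix.kroneckerMap (· * ·) Λ M) (Matrix.kroneckerMap (· * ·) B D) =
      tipP Λ B * tipP M D := by
  simp only [tipP, Matrix.kroneckerMap_apply, Fintype.sum_prod_type, Finset.sum_mul_sum]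
  refine Finset.sum_congr rfl fun a _ => Finset.sum_congr rfl fun c _ =>
    Finset.sum_congr rfl fun b _ => Finset.sum_congr rfl fun d _ => ?_
  rw [map_mul]; ring

theorem eval_tipP (x : Fin n → ℝ) (Λ : Matrix ι ι ℝ) (B : Matrix ι ι (MvPolynomial (Fin n) ℝ)) :
    MvPolynomial.eval x (tipP Λ B) = ∑ i, ∑ j, Λ i j * evalMat x B i j := by
  simp [tipP, evalMat]

/-- The multiplicative monoid of the polynomials `⟨Λ, G^{⊗k}⟩` with `Λ` positive semidefinite. -/
def kronPowSubmonoid (G : Matrix ι ι (MvPolynomial (Fin n) ℝ)) :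
    Submonoid (MvPolynomial (Fin n) ℝ) where
  carrier := {p | ∃ (k : ℕ) (Λ : Matrix (Fin k → ι) (Fin k → ι) ℝ),
    Λ.PosSemidef ∧ p = tipP Λ (kronPow G k)}
  one_mem' := by
    classical
    exact ⟨0, 1, Matrix.PosSemidef.one, by simp [tipP, kronPow]⟩
  mul_mem' := by
    rintro _ _ ⟨j, Λ, hΛ, rfl⟩ ⟨k, M, hM, rfl⟩
    refine ⟨j + k, _, (hΛ.kronecker hM).submatrix (Fin.appendEquiv j k).symm, ?_⟩
    rw [tipP_submatrix, kronPow_add, tipP_kroneckerMap]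

theorem tipP_mem_kronPowSubmonoid (G : Matrix ι ι (MvPolynomial (Fin n) ℝ)) {Λ : Matrix ι ι ℝ}
    (hΛ : Λ.PosSemidef) : tipP Λ G ∈ kronPowSubmonoid G :=
  ⟨1, _, hΛ.submatrix (Equiv.funUnique (Fin 1) ι), by
    rw [← Equiv.symm_symm (Equiv.funUnique (Fin 1) ι), tipP_submatrix, kronPow_one]⟩

theorem C_mem_kronPowSubmonoid (G : Matrix ι ι (MvPolynomial (Fin n) ℝ)) {r : ℝ} (hr : 0 ≤ r) :
    MvPolynomial.C r ∈ kronPowSubmonoid G := by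
  classical
  exact ⟨0, r • 1, Matrix.PosSemidef.one.smul hr, by simp [tipP, kronPow]⟩

theorem zero_mem_Hset (G : Matrix ι ι (MvPolynomial (Fin n) ℝ)) : 0 ∈ Hset G :=
  ⟨0, 0, fun _ => 0, le_rfl, by simp, by simp⟩

theorem tipP_kronPow_mem_Hset (G : Matrix ι ι (MvPolynomial (Fin n) ℝ)) {k : ℕ}
    {Λ : Matrix (Fin k → ι) (Fin k → ι) ℝ} (hΛ : Λ.PosSemidef) :
    tipP Λ (kronPow G k) ∈ Hset G := by
  rcases Nat.eq_zero_or_pos k with rfl | hk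
  · exact ⟨0, Λ default default, fun _ => 0, hΛ.diag_nonneg, by simp, by simp [tipP, kronPow]⟩
  · refine ⟨k, 0, Function.update (fun _ => 0) k Λ, le_rfl, fun j _ => ?_, ?_⟩
    · by_cases h : j = k
      · subst h; rwa [Function.update_self]
      · rw [Function.update_of_ne h]; exact Matrix.PosSemidef.zero
    · rw [map_zero, zero_add, Finset.sum_eq_single_of_mem k (Finset.mem_Icc.2 ⟨hk, le_rfl⟩),
        Function.update_self]
      intro j _ h
      rw [Function.update_of_ne h, tipP_zero]

theorem exists_extension_of_mem_Hset {G : Matrix ι ι (MvPolynomial (Fin n) ℝ)}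
    {p : MvPolynomial (Fin n) ℝ} (hp : p ∈ Hset G) :
    ∃ m : ℕ, ∀ m' ≥ m, ∃ (lam0 : ℝ) (Λ : (k : ℕ) → Matrix (Fin k → ι) (Fin k → ι) ℝ),
      0 ≤ lam0 ∧ (∀ k, (Λ k).PosSemidef) ∧
      p = MvPolynomial.C lam0 + ∑ k ∈ Finset.Icc 1 m', tipP (Λ k) (kronPow G k) := by
  obtain ⟨m, lam0, Λ, h0, hΛ, rfl⟩ := hp
  refine ⟨m, fun m' hm => ⟨lam0, fun k => if k ∈ Finset.Icc 1 m then Λ k else 0, h0,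
    fun k => ?_, ?_⟩⟩
  · dsimp only
    split_ifs with h
    · exact hΛ k h
    · exact Matrix.PosSemidef.zero
  · congr 1
    rw [← Finset.sum_subset (Finset.Icc_subset_Icc_right hm)]
    · exact Finset.sum_congr rfl fun k hk => by dsimp only; rw [if_pos hk]
    · intro k _ hk
      dsimp only
      rw [if_neg hk, tipP_zero]

theorem add_mem_Hset {G : Matrix ι ι (MvPolynomial (Fin n) ℝ)} {p r : MvPolynomial (Fin n) ℝ}
    (hp : p ∈ Hset G) (hr : r ∈ Hset G) : p + r ∈ Hset G := by
  obtain ⟨m, hm⟩ := exists_extension_of_mem_Hset hp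
  obtain ⟨m', hm'⟩ := exists_extension_of_mem_Hset hr
  obtain ⟨a, Λ, ha, hΛ, rfl⟩ := hm _ (le_max_left m m')
  obtain ⟨b, M, hb, hM, rfl⟩ := hm' _ (le_max_right m m')
  refine ⟨max m m', a + b, fun k => Λ k + M k, by positivity, fun k _ => (hΛ k).add (hM k), ?_⟩
  simp only [tipP_add, Finset.sum_add_distrib, map_add]
  ring

theorem subsemiringClosure_kronPowSubmonoid_subset (G : Matrix ι ι (MvPolynomial (Fin n) ℝ)) :
    ((kronPowSubmonoid G).subsemiringClosure : Set (MvPolynomial (Fin n) ℝ)) ⊆ Hset G := by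
  rw [Submonoid.subsemiringClosure_coe]
  intro p hp
  induction hp using AddSubmonoid.closure_induction with
  | mem p hp =>
    obtain ⟨k, Λ, hΛ, rfl⟩ := hp
    exact tipP_kronPow_mem_Hset G hΛ
  | zero => exact zero_mem_Hset G
  | add p r _ _ hp hr => exact add_mem_Hset hp hr

end tipP

theorem evalMat_linMat {n q : ℕ} (A0 : Matrix (Fin q) (Fin q) ℝ)
    (A : Fin n → Matrix (Fin q) (Fin q) ℝ) (x : Fin n → ℝ) :
    evalMat x (linMat A0 A) = A0 + ∑ l, x l • A l := by
  ext i j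
  simp [evalMat, linMat, Matrix.sum_apply]

theorem tipP_linMat {n q : ℕ} (A0 : Matrix (Fin q) (Fin q) ℝ)
    (A : Fin n → Matrix (Fin q) (Fin q) ℝ) (Λ : Matrix (Fin q) (Fin q) ℝ) :
    tipP Λ (linMat A0 A) = MvPolynomial.C (∑ i, ∑ j, Λ i j * A0 i j) +
      ∑ l, MvPolynomial.C (∑ i, ∑ j, Λ i j * A l i j) * MvPolynomial.X l := by
  simp only [tipP, linMat, Matrix.of_apply, map_sum, map_mul, mul_add, Finset.sum_add_distrib,
    Finset.mul_sum, Finset.sum_mul]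
  congr 1
  conv_rhs => rw [Finset.sum_comm]
  refine Finset.sum_congr rfl fun i _ => ?_
  conv_rhs => rw [Finset.sum_comm]
  exact Finset.sum_congr rfl fun j _ => Finset.sum_congr rfl fun l _ => by ring

theorem sum_vecMulVec_mul {ι : Type*} [Fintype ι] (v : ι → ℝ) (M : Matrix ι ι ℝ) :
    ∑ i, ∑ j, Matrix.vecMulVec v (star v) i j * M i j = dotProduct (star v) (M.mulVec v) := by
  simp only [dotProduct, Matrix.mulVec, Matrix.vecMulVec_apply, Finset.mul_sum]
  refine Finset.sum_congr rfl fun i _ => Finset.sum_congr rfl fun j _ => ?_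
  simp only [Pi.star_apply, star_trivial]
  ring

/-- If a spectrahedron is nonempty and bounded, every vector is the list of pairings of the
coefficient matrices with some positive semidefinite matrix. -/
theorem exists_posSemidef_forall_sum_eq {n q : ℕ} {A0 : Matrix (Fin q) (Fin q) ℝ}
    {A : Fin n → Matrix (Fin q) (Fin q) ℝ} (hA : ∀ l, (A l).IsSymm)
    (hne : {x : Fin n → ℝ | (A0 + ∑ l, x l • A l).PosSemidef}.Nonempty)
    (hbdd : Bornology.IsBounded {x : Fin n → ℝ | (A0 + ∑ l, x l • A l).PosSemidef})
    (c : Fin n → ℝ) :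
    ∃ Λ : Matrix (Fin q) (Fin q) ℝ, Λ.PosSemidef ∧ ∀ l, ∑ i, ∑ j, Λ i j * A l i j = c l := by
  let D : PointedCone ℝ (Fin n → ℝ) :=
    { carrier := {c | ∃ Λ : Matrix (Fin q) (Fin q) ℝ, Λ.PosSemidef ∧
        ∀ l, ∑ i, ∑ j, Λ i j * A l i j = c l}
      zero_mem' := ⟨0, Matrix.PosSemidef.zero, by simp⟩
      add_mem' := by
        rintro _ _ ⟨Λ, hΛ, h⟩ ⟨M, hM, h'⟩
        exact ⟨Λ + M, hΛ.add hM, fun l => by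
          simp [add_mul, Finset.sum_add_distrib, ← h, ← h']⟩
      smul_mem' := by
        rintro ⟨r, hr⟩ _ ⟨Λ, hΛ, h⟩
        refine ⟨r • Λ, hΛ.smul hr, fun l => ?_⟩
        change _ = r * _
        simp [← h, Finset.mul_sum, mul_assoc] }
  suffices hD : D = ⊤ from (hD ▸ trivial : c ∈ D)
  refine PointedCone.eq_top_of_forall_linearMap_eq_zero D fun g hg => ?_
  set y : Fin n → ℝ := fun l => g (Pi.single l 1) with hy
  have hgy : ∀ c, g c = ∑ l, y l * c l := fun c => by
    conv_lhs => rw [pi_eq_sum_univ' c, map_sum]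
    refine Finset.sum_congr rfl fun l _ => ?_
    rw [map_smul, smul_eq_mul, mul_comm]
  have hypsd : (∑ l, y l • A l).PosSemidef := by
    refine Matrix.posSemidef_iff_dotProduct_mulVec.2 ⟨?_, fun v => ?_⟩
    · rw [Matrix.IsHermitian, Matrix.conjTranspose_eq_transpose_of_trivial, Matrix.transpose_sum]
      exact Finset.sum_congr rfl fun l _ => by rw [Matrix.transpose_smul, (hA l).eq]
    · have := hg (fun l => ∑ i, ∑ j, Matrix.vecMulVec v (star v) i j * A l i j)
        ⟨_, Matrix.posSemidef_vecMulVec_self_star v, fun _ => rfl⟩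
      rw [hgy] at this
      simpa only [sum_vecMulVec_mul, Matrix.sum_mulVec, dotProduct_sum, Matrix.smul_mulVec,
        dotProduct_smul, smul_eq_mul] using this
  obtain ⟨x, hx⟩ := hne
  have hray : ∀ t : ℝ, 0 ≤ t → x + t • y ∈ {x : Fin n → ℝ | (A0 + ∑ l, x l • A l).PosSemidef} := by
    intro t ht
    have := hx.add (hypsd.smul ht)
    change (A0 + ∑ l, (x + t • y) l • A l).PosSemidef
    convert this using 1
    simp only [Pi.add_apply, Pi.smul_apply, add_smul, Finset.sum_add_distrib, Finset.smul_sum,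
      smul_assoc, add_assoc]
  obtain ⟨R, hR⟩ := hbdd.exists_norm_le
  have hy0 : y = 0 := by
    by_contra hne
    have hpos : 0 < ‖y‖ := norm_pos_iff.2 hne
    have hR0 : 0 ≤ R := (norm_nonneg _).trans (hR _ hx)
    have ht : 0 ≤ (2 * R + 1) / ‖y‖ := by positivity
    have h1 := hR _ (hray _ ht)
    have h2 : ‖((2 * R + 1) / ‖y‖) • y‖ = 2 * R + 1 := by
      rw [norm_smul, Real.norm_of_nonneg ht, div_mul_cancel₀ _ hpos.ne']
    have h3 := norm_sub_le (x + ((2 * R + 1) / ‖y‖) • y) x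
    rw [add_sub_cancel_left, h2] at h3
    linarith [hR _ hx]
  ext l
  simp [hgy, hy0]

/-- **Matrix Handelman Positivstellensatz (linear case).**
If `K = {x : G(x) := A₀ + ∑ xₗ Aₗ ⪰ 0}` is compact with nonempty interior and
`f` is positive on `K`, then `f = λ₀ + ∑_{k=1}^m ⟨Λ_k, G(x)^{⊗k}⟩` with `λ₀ ≥ 0`
and each `Λ_k` a `q^k × q^k` positive semidefinite matrix. -/
theorem matrix_handelman_linear {n q : ℕ}
    (A0 : Matrix (Fin q) (Fin q) ℝ) (A : Fin n → Matrix (Fin q) (Fin q) ℝ)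
    (hA0 : A0.IsSymm) (hA : ∀ l, (A l).IsSymm)
    (K : Set (Fin n → ℝ))
    (hK : K = {x | (evalMat x (linMat A0 A)).PosSemidef})
    (hcomp : IsCompact K)
    (hint : (interior K).Nonempty)
    (f : MvPolynomial (Fin n) ℝ)
    (hf : ∀ x ∈ K, 0 < MvPolynomial.eval x f) :
    ∃ (m : ℕ) (lam0 : ℝ)
      (Λ : (k : ℕ) → Matrix (Fin k → Fin q) (Fin k → Fin q) ℝ),
      0 ≤ lam0 ∧ (∀ k ∈ Finset.Icc 1 m, (Λ k).PosSemidef) ∧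
      f = MvPolynomial.C lam0 +
        ∑ k ∈ Finset.Icc 1 m, tipP (Λ k) (kronPow (linMat A0 A) k) := by
  have hne := hint.mono interior_subset
  have hbdd := hcomp.isBounded
  simp only [evalMat_linMat] at hK
  rw [hK] at hne hbdd
  have hpair := exists_posSemidef_forall_sum_eq hA hne hbdd
  set T := (kronPowSubmonoid (linMat A0 A)).subsemiringClosure with hTdef
  have hMT : ∀ p ∈ kronPowSubmonoid (linMat A0 A), p ∈ T := fun p hp => by
    rw [← SetLike.mem_coe, hTdef, Submonoid.subsemiringClosure_coe]
    exact AddSubmonoid.subset_closure hp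
  have hC : ∀ r : ℝ, 0 ≤ r → MvPolynomial.C r ∈ T := fun r hr =>
    hMT _ (C_mem_kronPowSubmonoid _ hr)
  have harch := exists_C_sub_mem_of_X T hC fun l => by
    have key : ∀ s : ℝ, ∃ N : ℝ,
        MvPolynomial.C N + MvPolynomial.C s * MvPolynomial.X l ∈ T := fun s => by
      obtain ⟨Λ, hΛ, h⟩ := hpair (Pi.single l s)
      have := hMT _ (tipP_mem_kronPowSubmonoid (linMat A0 A) hΛ)
      rw [tipP_linMat, Finset.sum_eq_single_of_mem l (Finset.mem_univ l)] at this
      · rw [h, Pi.single_eq_same] at this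
        exact ⟨_, this⟩
      · intro j _ hj
        rw [h, Pi.single_eq_of_ne hj, map_zero, zero_mul]
    obtain ⟨a, ha⟩ := key (-1)
    obtain ⟨b, hb⟩ := key 1
    exact ⟨⟨a, by simpa [← sub_eq_add_neg] using ha⟩, b, by simpa using hb⟩
  apply subsemiringClosure_kronPowSubmonoid_subset
  by_contra hfT
  obtain ⟨φ, hφ, hφf⟩ := exists_algHom_nonneg_of_notMem T hC harch hfT
  set x : Fin n → ℝ := φ ∘ MvPolynomial.X
  have hφx : ∀ p, φ p = MvPolynomial.eval x p := fun p => by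
    rw [MvPolynomial.aeval_unique φ, ← MvPolynomial.coe_aeval_eq_eval]
    rfl
  have hxK : x ∈ K := by
    rw [hK]
    refine Matrix.posSemidef_iff_dotProduct_mulVec.2 ⟨?_, fun v => ?_⟩
    · rw [Matrix.IsHermitian, Matrix.conjTranspose_eq_transpose_of_trivial, Matrix.transpose_add,
        Matrix.transpose_sum, hA0.eq]
      congr 1
      exact Finset.sum_congr rfl fun l _ => by rw [Matrix.transpose_smul, (hA l).eq]
    · have := hφ _ (hMT _ (tipP_mem_kronPowSubmonoid (linMat A0 A)
        (Matrix.posSemidef_vecMulVec_self_star v)))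
      rwa [hφx, eval_tipP, sum_vecMulVec_mul, evalMat_linMat] at this
  have := hf x hxK
  rw [← hφx] at this
  linarith

end
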